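/- Let m ≥ 1, n ≥ 0 be integers and x, ξ ∈ ℂ with Re x ≠ 0 and Re(ξ/x) < 1. Then the function x' ↦ J̃_{m,n}(x',ξ) is complex-differentiable at x, with derivative ∂_x J̃_{m,n}(x,ξ) = ((n+1)/x) · J̃_{m,n}(x,ξ) − (2π/x) · J̃_{m−1,n+1}(x,ξ). -/

import Mathlib

open MeasureTheory Real Filter

/-- The polylogarithm `Li_p(w) = ∑_{j ≥ 1} w^j / j^p`, for integer index `p`. -/
noncomputable def Li (p : ℤ) (w : ℂ) : ℂ := ∑' j : ℕ, w ^ (j + 1) / ((j : ℂ) + 1) ^ p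

/-- The integrand in the definition of `J̃_{m,n}(x,ξ)`. -/
noncomputable def Jtfun (m n : ℕ) (x ξ : ℂ) (s : ℝ) : ℂ :=
  (s : ℂ) ^ n *
    (Li m (Complex.exp (-(2 * (π : ℂ)) * (1 - ξ / x) * s)) / Complex.tanh ((π : ℂ) * s / x) -
      x / ((π : ℂ) * s) * Li m (Complex.exp (-(2 * (π : ℂ)) * s)))

/-- The function `J̃_{m,n}(x,ξ)`. -/
noncomputable def Jt (m n : ℕ) (x ξ : ℂ) : ℂ :=
  (-1 : ℂ) ^ (n + m + 1) * ∫ s in Set.Ioi (0 : ℝ), Jtfun m n x ξ s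


/-- The polylogarithm in the exponential variable, `Li_p(e^{-z})`. -/
noncomputable def liExp (p : ℤ) (z : ℂ) : ℂ := Li p (Complex.exp (-z))

theorem liExp_eq_tsum (p : ℤ) (z : ℂ) :
    liExp p z = ∑' j : ℕ, Complex.exp (-((j : ℂ) + 1) * z) / ((j : ℂ) + 1) ^ p := by
  unfold liExp Li
  congr 1
  ext j
  rw [← Complex.exp_nat_mul]
  congr 2
  push_cast
  ring

theorem rpow_le_mul_exp {α t : ℝ} (hα : 0 < α) (ht : 0 ≤ t) :
    t ^ α ≤ α ^ α * Real.exp t := by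
  have h : t / α ≤ Real.exp (t / α) := by linarith [Real.add_one_le_exp (t / α)]
  have h2 := Real.rpow_le_rpow (by positivity) h hα.le
  rw [Real.div_rpow ht hα.le, ← Real.exp_mul, div_mul_cancel₀ _ hα.ne',
    div_le_iff₀ (by positivity)] at h2
  linarith

theorem exp_term_le {p : ℤ} {α r : ℝ} (hα : 0 < α) (hr : 0 < r) (j : ℕ) :
    Real.exp (-((j : ℝ) + 1) * r) / ((j : ℝ) + 1) ^ p ≤
      (2 * α) ^ α * (r ^ (-α) * Real.exp (-(r / 2))) * ((j : ℝ) + 1) ^ (-(α + p)) := by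
  have hj : (0 : ℝ) < (j : ℝ) + 1 := by positivity
  have h1 := rpow_le_mul_exp hα (t := ((j : ℝ) + 1) * r / 2) (by positivity)
  have h2 : Real.exp (-((j : ℝ) + 1) * r) ≤
      Real.exp (-(r / 2)) * Real.exp (-(((j : ℝ) + 1) * r / 2)) := by
    rw [← Real.exp_add]
    apply Real.exp_le_exp.mpr
    have : 0 ≤ (j : ℝ) * r := by positivity
    linarith
  have h3 : Real.exp (-(((j : ℝ) + 1) * r / 2)) ≤
      (2 * α) ^ α * (r ^ (-α) * ((j : ℝ) + 1) ^ (-α)) := by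
    rw [Real.div_rpow (by positivity) (by norm_num), Real.mul_rpow hj.le hr.le] at h1
    rw [Real.exp_neg, Real.rpow_neg hr.le, Real.rpow_neg hj.le, Real.mul_rpow (by norm_num) hα.le]
    rw [div_le_iff₀ (by positivity)] at h1
    rw [inv_le_iff_one_le_mul₀ (by positivity), ← mul_inv, mul_right_comm, ← div_eq_mul_inv,
      le_div_iff₀ (by positivity)]
    linarith
  have h4 : ((j : ℝ) + 1) ^ (-(α + p)) = ((j : ℝ) + 1) ^ (-α) / ((j : ℝ) + 1) ^ p := by
    rw [neg_add, ← sub_eq_add_neg, Real.rpow_sub hj, Real.rpow_intCast]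
  rw [h4, ← mul_div_assoc]
  have hp : 0 < ((j : ℝ) + 1) ^ p := by positivity
  gcongr
  calc _ ≤ _ := h2
    _ ≤ Real.exp (-(r / 2)) * ((2 * α) ^ α * (r ^ (-α) * ((j : ℝ) + 1) ^ (-α))) := by gcongr
    _ = _ := by ring

theorem summable_succ_rpow {β : ℝ} (hβ : 1 < β) :
    Summable fun j : ℕ => ((j : ℝ) + 1) ^ (-β) := by
  have := (summable_nat_add_iff 1).mpr (Real.summable_nat_rpow.mpr (neg_lt_neg hβ))
  simpa using this

theorem summable_exp_term (p : ℤ) {r : ℝ} (hr : 0 < r) :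
    Summable fun j : ℕ => Real.exp (-((j : ℝ) + 1) * r) / ((j : ℝ) + 1) ^ p := by
  have hα : 0 < |(p : ℝ)| + 2 := by positivity
  refine Summable.of_nonneg_of_le (fun j => by positivity) (fun j => exp_term_le hα hr j) ?_
  exact (summable_succ_rpow (by linarith [neg_abs_le (p : ℝ)])).mul_left _

theorem norm_exp_term_le (p : ℤ) {r : ℝ} {z : ℂ} (h : r ≤ z.re) (j : ℕ) :
    ‖Complex.exp (-((j : ℂ) + 1) * z) / ((j : ℂ) + 1) ^ p‖ ≤
      Real.exp (-((j : ℝ) + 1) * r) / ((j : ℝ) + 1) ^ p := by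
  have hj : ‖((j : ℂ) + 1)‖ = (j : ℝ) + 1 := by
    exact_mod_cast Complex.norm_natCast (j + 1)
  have hp : 0 < ((j : ℝ) + 1) ^ p := by positivity
  rw [norm_div, norm_zpow, hj, Complex.norm_exp]
  gcongr
  have : (-((j : ℂ) + 1) * z).re = -((j : ℝ) + 1) * z.re := by simp
  rw [this]
  have : ((j : ℝ) + 1) * r ≤ ((j : ℝ) + 1) * z.re := by gcongr
  linarith

theorem exists_norm_liExp_le (p : ℤ) {α : ℝ} (hα : 0 < α) (h : 1 < α + p) :
    ∃ C : ℝ, 0 ≤ C ∧ ∀ (r : ℝ) (z : ℂ), 0 < r → r ≤ z.re →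
      ‖liExp p z‖ ≤ C * (r ^ (-α) * Real.exp (-(r / 2))) := by
  refine ⟨(2 * α) ^ α * ∑' j : ℕ, ((j : ℝ) + 1) ^ (-(α + p)), ?_, fun r z hr hz => ?_⟩
  · have : 0 ≤ ∑' j : ℕ, ((j : ℝ) + 1) ^ (-(α + p)) := tsum_nonneg fun j => by positivity
    positivity
  · rw [liExp_eq_tsum]
    have hs := ((summable_succ_rpow h).mul_left ((2 * α) ^ α * (r ^ (-α) * Real.exp (-(r / 2)))))
    refine (tsum_of_norm_bounded hs.hasSum
      fun j => (norm_exp_term_le p hz j).trans (exp_term_le hα hr j)).trans ?_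
    rw [tsum_mul_left]
    apply le_of_eq
    ring

theorem hasDerivAt_liExp (p : ℤ) {z : ℂ} (hz : 0 < z.re) :
    HasDerivAt (liExp p) (-liExp (p - 1) z) z := by
  have hr : 0 < z.re / 2 := by positivity
  have hopen : IsOpen {w : ℂ | z.re / 2 < w.re} := isOpen_lt continuous_const Complex.continuous_re
  have hconn : IsPreconnected {w : ℂ | z.re / 2 < w.re} :=
    (convex_halfSpace_re_gt (z.re / 2)).isPreconnected
  have hmem : z ∈ {w : ℂ | z.re / 2 < w.re} := by simp; linarith
  have key := hasDerivAt_tsum_of_isPreconnected (summable_exp_term (p - 1) hr) hopen hconn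
    (g := fun (j : ℕ) (w : ℂ) => Complex.exp (-((j : ℂ) + 1) * w) / ((j : ℂ) + 1) ^ p)
    (g' := fun (j : ℕ) (w : ℂ) => -(Complex.exp (-((j : ℂ) + 1) * w) / ((j : ℂ) + 1) ^ (p - 1)))
    (y₀ := z) (y := z) ?_ ?_ hmem ?_ hmem
  · rw [tsum_neg, ← liExp_eq_tsum] at key
    simpa only [← liExp_eq_tsum] using key
  · intro j w _
    have hj : ((j : ℂ) + 1) ≠ 0 := by exact_mod_cast Nat.succ_ne_zero j
    have h1 : HasDerivAt (fun w : ℂ => -((j : ℂ) + 1) * w) (-((j : ℂ) + 1)) w := by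
      simpa using (hasDerivAt_id w).const_mul (-((j : ℂ) + 1))
    refine (h1.cexp.div_const (((j : ℂ) + 1) ^ p)).congr_deriv ?_
    rw [zpow_sub_one₀ hj]
    field_simp
  · intro j w hw
    rw [norm_neg]
    exact norm_exp_term_le _ hw.le j
  · exact Summable.of_norm_bounded (summable_exp_term p hz) fun j => norm_exp_term_le p le_rfl j

theorem norm_liExp_sub_le {p : ℤ} {B r : ℝ}
    (hB : ∀ z : ℂ, r ≤ z.re → ‖liExp (p - 1) z‖ ≤ B) (hr : 0 < r) {z w : ℂ}
    (hz : r ≤ z.re) (hw : r ≤ w.re) : ‖liExp p z - liExp p w‖ ≤ B * ‖z - w‖ := by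
  refine (convex_halfSpace_re_ge r).norm_image_sub_le_of_norm_hasDerivWithin_le
    (f' := fun z => -liExp (p - 1) z)
    (fun y hy => (hasDerivAt_liExp p (hr.trans_le hy)).hasDerivWithinAt) (fun y hy => ?_) hw hz
  rw [norm_neg]
  exact hB y hy

theorem abs_re_le_norm_sinh (z : ℂ) : |z.re| ≤ ‖Complex.sinh z‖ := by
  wlog h : 0 ≤ z.re generalizing z
  · simpa using this (-z) (by simp; linarith)
  have h1 : Real.sinh z.re ≤ ‖Complex.sinh z‖ := by
    rw [Complex.sinh, Real.sinh_eq, norm_div, Complex.norm_ofNat]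
    have := norm_sub_norm_le (Complex.exp z) (Complex.exp (-z))
    rw [Complex.norm_exp, Complex.norm_exp, Complex.neg_re] at this
    gcongr
  rw [abs_of_nonneg h]
  exact (Real.self_le_sinh_iff.mpr h).trans h1

theorem sinh_ne_zero_of_re_ne_zero {z : ℂ} (hz : z.re ≠ 0) : Complex.sinh z ≠ 0 :=
  norm_pos_iff.mp ((abs_pos.mpr hz).trans_le (abs_re_le_norm_sinh z))

theorem norm_cosh_le_norm_sinh_add_one (z : ℂ) : ‖Complex.cosh z‖ ≤ ‖Complex.sinh z‖ + 1 := by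
  wlog h : 0 ≤ z.re generalizing z
  · simpa using this (-z) (by simp; linarith)
  have h1 : Complex.cosh z = Complex.sinh z + Complex.exp (-z) := by
    rw [← Complex.cosh_sub_sinh]; ring
  rw [h1]
  refine (norm_add_le _ _).trans ?_
  gcongr
  rw [Complex.norm_exp]
  simpa using h

theorem inv_tanh_eq (z : ℂ) : (Complex.tanh z)⁻¹ = Complex.cosh z / Complex.sinh z := by
  rw [Complex.tanh_eq_sinh_div_cosh, inv_div]

theorem norm_inv_tanh_le {z : ℂ} (hz : z.re ≠ 0) : ‖(Complex.tanh z)⁻¹‖ ≤ 1 + 1 / |z.re| := by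
  have hs : 0 < ‖Complex.sinh z‖ := norm_pos_iff.mpr (sinh_ne_zero_of_re_ne_zero hz)
  have hr : 0 < |z.re| := abs_pos.mpr hz
  rw [inv_tanh_eq, norm_div]
  calc _ ≤ (‖Complex.sinh z‖ + 1) / ‖Complex.sinh z‖ := by
        gcongr; exact norm_cosh_le_norm_sinh_add_one z
    _ = 1 + 1 / ‖Complex.sinh z‖ := by field_simp
    _ ≤ _ := by gcongr; exact abs_re_le_norm_sinh z

theorem norm_sinh_le_exp_norm (z : ℂ) : ‖Complex.sinh z‖ ≤ Real.exp ‖z‖ := by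
  rw [Complex.sinh, norm_div, Complex.norm_ofNat, div_le_iff₀ (by norm_num)]
  refine (norm_sub_le _ _).trans ?_
  have h1 := Complex.norm_exp_le_exp_norm z
  have h2 := Complex.norm_exp_le_exp_norm (-z)
  rw [norm_neg] at h2
  linarith

theorem norm_mul_cosh_sub_sinh_le (z : ℂ) :
    ‖z * Complex.cosh z - Complex.sinh z‖ ≤ ‖z‖ * Real.exp ‖z‖ * ‖z‖ := by
  have hd : ∀ w ∈ Metric.closedBall (0 : ℂ) ‖z‖,
      HasDerivWithinAt (fun w => w * Complex.cosh w - Complex.sinh w) (w * Complex.sinh w)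
        (Metric.closedBall (0 : ℂ) ‖z‖) w := fun w _ => by
    refine ((((hasDerivAt_id w).mul (Complex.hasDerivAt_cosh w)).sub
      (Complex.hasDerivAt_sinh w)).congr_deriv ?_).hasDerivWithinAt
    simp
  have := (convex_closedBall (0 : ℂ) ‖z‖).norm_image_sub_le_of_norm_hasDerivWithin_le hd
    (C := ‖z‖ * Real.exp ‖z‖) (fun w hw => ?_) (x := 0) (y := z) (by simp) (by simp)
  · simpa using this
  · rw [mem_closedBall_zero_iff] at hw
    rw [norm_mul]
    gcongr
    exact (norm_sinh_le_exp_norm w).trans (Real.exp_le_exp.mpr hw)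

theorem norm_inv_tanh_sub_inv_le {K : ℝ} {z : ℂ} (hz : z.re ≠ 0) (hK : ‖z‖ ≤ K * |z.re|) :
    ‖(Complex.tanh z)⁻¹ - z⁻¹‖ ≤ 3 + K * Real.exp K := by
  have hr : 0 < |z.re| := abs_pos.mpr hz
  have hz0 : z ≠ 0 := by rintro rfl; simp at hz
  have hK0 : 0 ≤ K := by
    by_contra! h
    nlinarith [norm_nonneg z]
  rcases le_total 1 |z.re| with h | h
  · have h1 := norm_inv_tanh_le hz
    have h2 : 1 / |z.re| ≤ 1 := by rwa [div_le_one hr]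
    have h3 : ‖z⁻¹‖ ≤ 1 := by
      rw [norm_inv]
      exact inv_le_one_of_one_le₀ (h.trans (Complex.abs_re_le_norm z))
    have h4 : 0 ≤ K * Real.exp K := by positivity
    linarith [norm_sub_le (Complex.tanh z)⁻¹ z⁻¹]
  · have hs := sinh_ne_zero_of_re_ne_zero hz
    have h1 : (Complex.tanh z)⁻¹ - z⁻¹ =
        (z * Complex.cosh z - Complex.sinh z) / (z * Complex.sinh z) := by
      rw [inv_tanh_eq]
      field_simp
    have hzK : ‖z‖ ≤ K := hK.trans (by nlinarith)
    rw [h1, norm_div, norm_mul]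
    have hn : 0 < ‖z‖ := norm_pos_iff.mpr hz0
    calc _ ≤ (‖z‖ * Real.exp ‖z‖ * ‖z‖) / (‖z‖ * |z.re|) := by
          gcongr
          · exact norm_mul_cosh_sub_sinh_le z
          · exact abs_re_le_norm_sinh z
      _ = ‖z‖ / |z.re| * Real.exp ‖z‖ := by field_simp
      _ ≤ K * Real.exp K := by
          gcongr
          rwa [div_le_iff₀ hr]
      _ ≤ _ := by linarith

theorem hasDerivAt_inv_tanh {z : ℂ} (hz : z.re ≠ 0) :
    HasDerivAt (fun z => (Complex.tanh z)⁻¹) (-(1 / Complex.sinh z ^ 2)) z := by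
  have hs := sinh_ne_zero_of_re_ne_zero hz
  simp only [inv_tanh_eq]
  refine ((Complex.hasDerivAt_cosh z).div (Complex.hasDerivAt_sinh z) hs).congr_deriv ?_
  rw [← neg_div]
  congr 1
  linear_combination -Complex.cosh_sq_sub_sinh_sq z

/-- The part of the integrand `Jtfun m n x ξ` without the pole of `1 / tanh` at the origin. -/
noncomputable def JtfunReg (m n : ℕ) (x ξ : ℂ) (s : ℝ) : ℂ :=
  (s : ℂ) ^ n * (liExp m (2 * π * (1 - ξ / x) * s) *
    ((Complex.tanh (π * s / x))⁻¹ - (π * s / x : ℂ)⁻¹))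

/-- The part of the integrand `Jtfun m n x ξ` coming from the pole of `1 / tanh` at the origin. -/
noncomputable def JtfunSing (m n : ℕ) (x ξ : ℂ) (s : ℝ) : ℂ :=
  (s : ℂ) ^ n * (x / (π * s) * (liExp m (2 * π * (1 - ξ / x) * s) - liExp m (2 * π * s)))

theorem Jtfun_eq (m n : ℕ) (x ξ : ℂ) (s : ℝ) :
    Jtfun m n x ξ s = (s : ℂ) ^ n * (liExp m (2 * π * (1 - ξ / x) * s) *
      (Complex.tanh (π * s / x))⁻¹ - x / (π * s) * liExp m (2 * π * s)) := by
  simp only [Jtfun, liExp, div_eq_mul_inv, neg_mul]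

theorem Jtfun_eq_add (m n : ℕ) (x ξ : ℂ) (s : ℝ) :
    Jtfun m n x ξ s = JtfunReg m n x ξ s + JtfunSing m n x ξ s := by
  rw [Jtfun_eq, JtfunReg, JtfunSing, inv_div]
  ring

/-- A quantitative form of the conditions `Re x ≠ 0` and `Re (ξ / x) < 1`. -/
structure Adm (δ M : ℝ) (ξ x : ℂ) : Prop where
  norm_le : ‖x‖ ≤ M
  norm_inv_le : ‖x⁻¹‖ ≤ M
  le_abs_re : δ ≤ |x⁻¹.re|
  le_re : δ ≤ (1 - ξ / x).re

theorem inv_re_ne_zero {x : ℂ} (hx : x.re ≠ 0) : x⁻¹.re ≠ 0 := by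
  have h0 : x ≠ 0 := by rintro rfl; simp at hx
  rw [Complex.inv_re]
  exact div_ne_zero hx (Complex.normSq_pos.mpr h0).ne'

theorem exists_eventually_adm {x ξ : ℂ} (hx : x.re ≠ 0) (hξ : (ξ / x).re < 1) :
    ∃ δ M : ℝ, 0 < δ ∧ δ ≤ 1 ∧ ∀ᶠ y in nhds x, Adm δ M ξ y := by
  have h0 : x ≠ 0 := by rintro rfl; simp at hx
  have h1 : 0 < |x⁻¹.re| := abs_pos.mpr (inv_re_ne_zero hx)
  have h2 : 0 < (1 - ξ / x).re := by simpa using hξ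
  obtain ⟨δ, hδ0, hδ⟩ := exists_between (lt_min one_pos (lt_min h1 h2))
  obtain ⟨M, hM⟩ := exists_gt (max ‖x‖ ‖x⁻¹‖)
  rw [lt_min_iff, lt_min_iff] at hδ
  rw [max_lt_iff] at hM
  refine ⟨δ, M, hδ0, hδ.1.le, ?_⟩
  have ci : ContinuousAt (fun y : ℂ => y⁻¹) x := continuousAt_inv₀ h0
  have e1 : ∀ᶠ y in nhds x, ‖y‖ < M := continuous_norm.continuousAt.eventually_lt_const hM.1
  have e2 := ci.norm.eventually_lt_const hM.2
  have e3 := ((Complex.continuous_re.continuousAt.comp ci).abs).eventually_const_lt hδ.2.1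
  have e4 : ∀ᶠ y in nhds x, δ < (1 - ξ / y).re := by
    have : ContinuousAt (fun y : ℂ => (1 - ξ / y).re) x :=
      Complex.continuous_re.continuousAt.comp
        (continuousAt_const.sub (continuousAt_const.div continuousAt_id h0))
    exact this.eventually_const_lt hδ.2.2
  filter_upwards [e1, e2, e3, e4] with y a b c d
  exact ⟨a.le, b.le, c.le, d.le⟩

theorem Adm.re_mul_le {δ M : ℝ} {ξ x : ℂ} (h : Adm δ M ξ x) {s : ℝ} (hs : 0 < s) :
    2 * π * δ * s ≤ (2 * π * (1 - ξ / x) * s : ℂ).re := by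
  have : (2 * π * (1 - ξ / x) * s : ℂ).re = 2 * π * (1 - ξ / x).re * s := by
    have : (2 * π * (1 - ξ / x) * s : ℂ) = ((2 * π * s : ℝ) : ℂ) * (1 - ξ / x) := by
      push_cast; ring
    rw [this, Complex.re_ofReal_mul]
    ring
  rw [this]
  have := h.le_re
  gcongr

theorem pi_mul_div_re (x : ℂ) (s : ℝ) : (π * s / x : ℂ).re = π * s * x⁻¹.re := by
  have : (π * s / x : ℂ) = ((π * s : ℝ) : ℂ) * x⁻¹ := by push_cast; ring
  rw [this, Complex.re_ofReal_mul]

theorem Adm.norm_inv_tanh_sub_le {δ M : ℝ} {ξ x : ℂ} (hδ : 0 < δ) (h : Adm δ M ξ x) {s : ℝ}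
    (hs : 0 < s) : ‖(Complex.tanh (π * s / x))⁻¹ - (π * s / x : ℂ)⁻¹‖ ≤
      3 + M / δ * Real.exp (M / δ) := by
  have hre := h.le_abs_re
  have hne : x⁻¹.re ≠ 0 := abs_pos.mp (hδ.trans_le hre)
  have hM : 0 ≤ M := (norm_nonneg x).trans h.norm_le
  apply norm_inv_tanh_sub_inv_le
  · rw [pi_mul_div_re]
    have := pi_pos
    positivity
  · rw [pi_mul_div_re, abs_mul, abs_of_pos (by positivity : 0 < π * s)]
    have : ‖(π * s / x : ℂ)‖ = π * s * ‖x⁻¹‖ := by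
      rw [div_eq_mul_inv, norm_mul, norm_mul, Complex.norm_real, Complex.norm_real,
        Real.norm_of_nonneg pi_pos.le, Real.norm_of_nonneg hs.le]
    rw [this]
    calc π * s * ‖x⁻¹‖ ≤ π * s * (M / δ * δ) := by
          rw [div_mul_cancel₀ _ hδ.ne']
          have := h.norm_inv_le
          gcongr
      _ ≤ π * s * (M / δ * |x⁻¹.re|) := by gcongr
      _ = _ := by ring

theorem pow_mul_rpow_mul_exp (n : ℕ) {δ s : ℝ} (hδ : 0 < δ) (hs : 0 < s) :
    s ^ n * ((2 * π * δ * s) ^ (-((n : ℝ) + 1 / 2)) * Real.exp (-(2 * π * δ * s / 2))) =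
      (2 * π * δ) ^ (-((n : ℝ) + 1 / 2)) * (s ^ (-(1 / 2) : ℝ) * Real.exp (-(π * δ) * s)) := by
  have h1 : s ^ n * s ^ (-((n : ℝ) + 1 / 2)) = s ^ (-(1 / 2) : ℝ) := by
    rw [← Real.rpow_natCast, ← Real.rpow_add hs]
    congr 1
    ring
  have h2 : -(2 * π * δ * s / 2) = -(π * δ) * s := by ring
  rw [Real.mul_rpow (by positivity) hs.le, h2, ← h1]
  ring

theorem exists_norm_JtfunReg_le (m n : ℕ) (ξ : ℂ) (hmn : 1 ≤ m + n) {δ : ℝ} (M : ℝ) (hδ : 0 < δ) :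
    ∃ C : ℝ, ∀ x, Adm δ M ξ x → ∀ s : ℝ, 0 < s →
      ‖JtfunReg m n x ξ s‖ ≤ C * (s ^ (-(1 / 2) : ℝ) * Real.exp (-(π * δ) * s)) := by
  have hα : (1 : ℝ) < ((n : ℝ) + 1 / 2) + ((m : ℤ) : ℝ) := by
    have : (1 : ℝ) ≤ m + n := by exact_mod_cast hmn
    push_cast
    linarith
  obtain ⟨C, hC0, hC⟩ := exists_norm_liExp_le m (by positivity) hα
  refine ⟨C * (2 * π * δ) ^ (-((n : ℝ) + 1 / 2)) * (3 + M / δ * Real.exp (M / δ)),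
    fun x hx s hs => ?_⟩
  have h1 := hC _ _ (by positivity) (hx.re_mul_le hs)
  have h2 := hx.norm_inv_tanh_sub_le hδ hs
  rw [JtfunReg, norm_mul, norm_mul, norm_pow, Complex.norm_real, Real.norm_of_nonneg hs.le]
  calc _ ≤ s ^ n * ((C * ((2 * π * δ * s) ^ (-((n : ℝ) + 1 / 2)) *
        Real.exp (-(2 * π * δ * s / 2)))) * (3 + M / δ * Real.exp (M / δ))) := by gcongr
    _ = C * (s ^ n * ((2 * π * δ * s) ^ (-((n : ℝ) + 1 / 2)) *
        Real.exp (-(2 * π * δ * s / 2)))) * (3 + M / δ * Real.exp (M / δ)) := by ring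
    _ = _ := by rw [pow_mul_rpow_mul_exp n hδ hs]; ring

theorem exists_norm_JtfunSing_le (m n : ℕ) (ξ : ℂ) (hmn : ξ = 0 ∨ 2 ≤ m + n) {δ : ℝ} (M : ℝ)
    (hδ : 0 < δ) (hδ1 : δ ≤ 1) :
    ∃ C : ℝ, ∀ x, Adm δ M ξ x → ∀ s : ℝ, 0 < s →
      ‖JtfunSing m n x ξ s‖ ≤ C * (s ^ (-(1 / 2) : ℝ) * Real.exp (-(π * δ) * s)) := by
  rcases hmn with rfl | hmn
  · exact ⟨0, fun x _ s _ => by simp [JtfunSing]⟩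
  have hα : (1 : ℝ) < ((n : ℝ) + 1 / 2) + ((m - 1 : ℤ) : ℝ) := by
    have : (2 : ℝ) ≤ m + n := by exact_mod_cast hmn
    push_cast
    linarith
  obtain ⟨C, hC0, hC⟩ := exists_norm_liExp_le (m - 1) (by positivity) hα
  refine ⟨2 * M * M * ‖ξ‖ * C * (2 * π * δ) ^ (-((n : ℝ) + 1 / 2)), fun x hx s hs => ?_⟩
  have hM : 0 ≤ M := (norm_nonneg x).trans hx.norm_le
  have h2 : 2 * π * δ * s ≤ (2 * π * s : ℂ).re := by
    have : (2 * π * s : ℂ).re = 2 * π * s := by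
      rw [show (2 * π * s : ℂ) = ((2 * π * s : ℝ) : ℂ) by push_cast; ring, Complex.ofReal_re]
    rw [this]
    calc 2 * π * δ * s ≤ 2 * π * 1 * s := by gcongr
      _ = _ := by ring
  have h1 := norm_liExp_sub_le (fun z hz => hC _ z (by positivity) hz) (by positivity)
    (hx.re_mul_le hs) h2
  have h3 : ‖(2 * π * (1 - ξ / x) * s : ℂ) - 2 * π * s‖ ≤ 2 * π * s * (‖ξ‖ * M) := by
    rw [show (2 * π * (1 - ξ / x) * s : ℂ) - 2 * π * s = -(((2 * π * s : ℝ) : ℂ) * (ξ * x⁻¹)) by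
      push_cast; ring, norm_neg, norm_mul, norm_mul, Complex.norm_real,
      Real.norm_of_nonneg (by positivity)]
    have := hx.norm_inv_le
    gcongr
  have h4 : ‖x / (π * s : ℂ)‖ ≤ M / (π * s) := by
    rw [norm_div, norm_mul, Complex.norm_real, Complex.norm_real,
        Real.norm_of_nonneg pi_pos.le, Real.norm_of_nonneg hs.le]
    have := hx.norm_le
    gcongr
  rw [JtfunSing, norm_mul, norm_mul, norm_pow, Complex.norm_real, Real.norm_of_nonneg hs.le]
  have h5 := h1.trans (mul_le_mul_of_nonneg_left h3 (by positivity))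
  calc _ ≤ s ^ n * (M / (π * s) * (C * ((2 * π * δ * s) ^ (-((n : ℝ) + 1 / 2)) *
        Real.exp (-(2 * π * δ * s / 2))) * (2 * π * s * (‖ξ‖ * M)))) := by gcongr
    _ = 2 * M * M * ‖ξ‖ * C * (s ^ n * ((2 * π * δ * s) ^ (-((n : ℝ) + 1 / 2)) *
        Real.exp (-(2 * π * δ * s / 2)))) := by
        have := pi_pos
        field_simp
    _ = _ := by rw [pow_mul_rpow_mul_exp n hδ hs]; ring

theorem exists_norm_Jtfun_le (m n : ℕ) (ξ : ℂ) (h1 : 1 ≤ m + n) (h2 : ξ = 0 ∨ 2 ≤ m + n) {δ : ℝ}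
    (M : ℝ) (hδ : 0 < δ) (hδ1 : δ ≤ 1) :
    ∃ C : ℝ, ∀ x, Adm δ M ξ x → ∀ s : ℝ, 0 < s →
      ‖Jtfun m n x ξ s‖ ≤ C * (s ^ (-(1 / 2) : ℝ) * Real.exp (-(π * δ) * s)) := by
  obtain ⟨A, hA⟩ := exists_norm_JtfunReg_le m n ξ h1 M hδ
  obtain ⟨B, hB⟩ := exists_norm_JtfunSing_le m n ξ h2 M hδ hδ1
  refine ⟨A + B, fun x hx s hs => ?_⟩
  rw [Jtfun_eq_add, add_mul]
  exact (norm_add_le _ _).trans (add_le_add (hA x hx s hs) (hB x hx s hs))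

theorem integrableOn_rpow_mul_exp {c : ℝ} (hc : 0 < c) :
    IntegrableOn (fun s : ℝ => s ^ (-(1 / 2) : ℝ) * Real.exp (-c * s)) (Set.Ioi 0) := by
  simpa using integrableOn_rpow_mul_exp_neg_mul_rpow (p := 1) (s := -(1 / 2)) (b := c)
    (by norm_num) one_pos hc

theorem re_two_pi_mul_pos {a : ℂ} (ha : 0 < a.re) {s : ℝ} (hs : 0 < s) :
    0 < (2 * π * a * s : ℂ).re := by
  rw [show (2 * π * a * s : ℂ) = ((2 * π * s : ℝ) : ℂ) * a by push_cast; ring,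
    Complex.re_ofReal_mul]
  positivity

theorem re_pi_mul_div_ne_zero {x : ℂ} (hx : x.re ≠ 0) {s : ℝ} (hs : 0 < s) :
    (π * s / x : ℂ).re ≠ 0 := by
  rw [pi_mul_div_re]
  exact mul_ne_zero (by positivity) (inv_re_ne_zero hx)

/-- The derivative of `Jtfun (k + 1) n x ξ s` with respect to `x`. -/
noncomputable def JtfunDeriv (k n : ℕ) (x ξ : ℂ) (s : ℝ) : ℂ :=
  (s : ℂ) ^ n * (-liExp k (2 * π * (1 - ξ / x) * s) * (2 * π * (ξ / x ^ 2) * s) *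
      (Complex.tanh (π * s / x))⁻¹ +
    liExp (k + 1) (2 * π * (1 - ξ / x) * s) *
      (1 / Complex.sinh (π * s / x) ^ 2 * (π * s / x ^ 2)) -
    1 / (π * s) * liExp (k + 1) (2 * π * s))

theorem hasDerivAt_liExp_succ (k : ℕ) {z : ℂ} (hz : 0 < z.re) :
    HasDerivAt (liExp (k + 1)) (-liExp k z) z := by
  simpa using hasDerivAt_liExp (k + 1) hz

theorem hasDerivAt_Jtfun (k n : ℕ) {x ξ : ℂ} (hx : x.re ≠ 0) (hξ : 0 < (1 - ξ / x).re) {s : ℝ}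
    (hs : 0 < s) :
    HasDerivAt (fun y => Jtfun (k + 1) n y ξ s) (JtfunDeriv k n x ξ s) x := by
  have h0 : x ≠ 0 := by rintro rfl; simp at hx
  have hinv : ∀ c : ℂ, HasDerivAt (fun y : ℂ => c / y) (-(c / x ^ 2)) x := fun c => by
    refine ((hasDerivAt_const x c).div (hasDerivAt_id x) h0).congr_deriv ?_
    simp [neg_div]
  have hu : HasDerivAt (fun y : ℂ => (2 * π * (1 - ξ / y) * s : ℂ)) (2 * π * (ξ / x ^ 2) * s) x := by
    refine ((((hinv ξ).const_sub 1).const_mul (2 * π : ℂ)).mul_const (s : ℂ)).congr_deriv ?_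
    ring
  have hL := (hasDerivAt_liExp_succ k (re_two_pi_mul_pos hξ hs)).comp x hu
  have hT := (hasDerivAt_inv_tanh (re_pi_mul_div_ne_zero hx hs)).comp x (hinv (π * s))
  have hlast : HasDerivAt (fun y : ℂ => y / (π * s) * liExp (k + 1) (2 * π * s))
      (1 / (π * s) * liExp (k + 1) (2 * π * s)) x :=
    ((hasDerivAt_id x).div_const _).mul_const _
  have := ((hL.mul hT).sub hlast).const_mul ((s : ℂ) ^ n)
  simp only [Jtfun_eq, Nat.cast_add, Nat.cast_one]
  refine this.congr_deriv ?_
  simp only [JtfunDeriv, Function.comp]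
  ring

theorem hasDerivAt_mul_Jtfun (k n : ℕ) {x ξ : ℂ} (hx : x.re ≠ 0) (hξ : 0 < (1 - ξ / x).re) {s : ℝ}
    (hs : 0 < s) :
    HasDerivAt (fun t : ℝ => (t : ℂ) * Jtfun (k + 1) n x ξ t)
      ((n + 1) * Jtfun (k + 1) n x ξ s - 2 * π * Jtfun k (n + 1) x ξ s -
        x * JtfunDeriv k n x ξ s) s := by
  have h0 : x ≠ 0 := by rintro rfl; simp at hx
  have hs0 : (s : ℂ) ≠ 0 := by exact_mod_cast hs.ne'
  have hπ : (π : ℂ) ≠ 0 := by exact_mod_cast pi_ne_zero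
  have hid := hasDerivAt_id (s : ℂ)
  have hu : HasDerivAt (fun t : ℂ => (2 * π * (1 - ξ / x) * t : ℂ)) (2 * π * (1 - ξ / x)) s := by
    simpa using hid.const_mul (2 * π * (1 - ξ / x) : ℂ)
  have hw : HasDerivAt (fun t : ℂ => (2 * π * t : ℂ)) (2 * π) s := by
    simpa using hid.const_mul (2 * π : ℂ)
  have hv : HasDerivAt (fun t : ℂ => (π * t / x : ℂ)) (π / x) s := by
    simpa using (hid.const_mul (π : ℂ)).div_const x
  have hL := (hasDerivAt_liExp_succ k (re_two_pi_mul_pos hξ hs)).comp (s : ℂ) hu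
  have hT := (hasDerivAt_inv_tanh (re_pi_mul_div_ne_zero hx hs)).comp (s : ℂ) hv
  have hL' := (hasDerivAt_liExp_succ k
    (by simpa using re_two_pi_mul_pos (a := 1) (by simp) hs)).comp (s : ℂ) hw
  have hp : HasDerivAt (fun t : ℂ => t ^ (n + 1)) ((n + 1) * (s : ℂ) ^ n) s := by
    simpa using hasDerivAt_pow (n + 1) (s : ℂ)
  have hd : HasDerivAt (fun t : ℂ => x / (π * t)) (-(x / (π * s ^ 2))) s := by
    refine ((hasDerivAt_const (s : ℂ) x).div (hid.const_mul (π : ℂ))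
      (mul_ne_zero hπ hs0)).congr_deriv ?_
    simp only [id]
    field_simp
    ring
  have := (hp.mul ((hL.mul hT).sub (hd.mul hL'))).comp_ofReal
  refine (this.congr_of_eventuallyEq (Eventually.of_forall fun t => ?_)).congr_deriv ?_
  · simp only [Jtfun_eq, Nat.cast_add, Nat.cast_one, Pi.mul_apply, Pi.sub_apply, Function.comp]
    ring
  · have hsh := sinh_ne_zero_of_re_ne_zero (re_pi_mul_div_ne_zero hx hs)
    simp only [Jtfun_eq, JtfunDeriv, Nat.cast_add, Nat.cast_one, Pi.mul_apply, Pi.sub_apply,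
      Function.comp]
    field_simp
    ring

theorem continuousOn_liExp (p : ℤ) : ContinuousOn (liExp p) {z | 0 < z.re} :=
  fun _ hz => (hasDerivAt_liExp p hz).continuousAt.continuousWithinAt

theorem continuousOn_liExp_comp (p : ℤ) {a : ℂ} (ha : 0 < a.re) :
    ContinuousOn (fun s : ℝ => liExp p (2 * π * a * s)) (Set.Ioi 0) :=
  (continuousOn_liExp p).comp (by fun_prop) fun _ hs => re_two_pi_mul_pos ha hs

theorem continuousOn_liExp_two_pi (p : ℤ) :
    ContinuousOn (fun s : ℝ => liExp p (2 * π * s)) (Set.Ioi 0) := by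
  simpa using continuousOn_liExp_comp p (a := 1) (by simp)

theorem continuousOn_inv_tanh_comp {x : ℂ} (hx : x.re ≠ 0) :
    ContinuousOn (fun s : ℝ => (Complex.tanh (π * s / x))⁻¹) (Set.Ioi 0) :=
  ContinuousOn.comp (g := fun z => (Complex.tanh z)⁻¹) (t := {z | z.re ≠ 0})
    (fun _ hz => (hasDerivAt_inv_tanh hz).continuousAt.continuousWithinAt)
    (by fun_prop) fun _ hs => re_pi_mul_div_ne_zero hx hs

theorem pi_mul_ofReal_ne_zero {s : ℝ} (hs : s ∈ Set.Ioi (0 : ℝ)) : (π * s : ℂ) ≠ 0 := by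
  exact_mod_cast (mul_pos pi_pos hs).ne'

theorem continuousOn_JtfunReg (m n : ℕ) {x ξ : ℂ} (hx : x.re ≠ 0) (hξ : 0 < (1 - ξ / x).re) :
    ContinuousOn (JtfunReg m n x ξ) (Set.Ioi 0) := by
  have h1 := continuousOn_liExp_comp m hξ
  have h2 := continuousOn_inv_tanh_comp hx
  have h0 : x ≠ 0 := by rintro rfl; simp at hx
  have h3 : ContinuousOn (fun s : ℝ => (π * s / x : ℂ)⁻¹) (Set.Ioi 0) :=
    ContinuousOn.inv₀ (by fun_prop) fun s hs => div_ne_zero (pi_mul_ofReal_ne_zero hs) h0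
  unfold JtfunReg
  fun_prop

theorem continuousOn_Jtfun (m n : ℕ) {x ξ : ℂ} (hx : x.re ≠ 0) (hξ : 0 < (1 - ξ / x).re) :
    ContinuousOn (Jtfun m n x ξ) (Set.Ioi 0) := by
  have h1 := continuousOn_liExp_comp m hξ
  have h2 := continuousOn_inv_tanh_comp hx
  have h3 : ContinuousOn (fun s : ℝ => x / (π * s : ℂ)) (Set.Ioi 0) :=
    ContinuousOn.div (by fun_prop) (by fun_prop) fun s hs => pi_mul_ofReal_ne_zero hs
  have h4 := continuousOn_liExp_two_pi m
  simp only [funext (Jtfun_eq m n x ξ)]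
  fun_prop

theorem continuousOn_JtfunDeriv (k n : ℕ) {x ξ : ℂ} (hx : x.re ≠ 0) (hξ : 0 < (1 - ξ / x).re) :
    ContinuousOn (JtfunDeriv k n x ξ) (Set.Ioi 0) := by
  have h1 := continuousOn_liExp_comp k hξ
  have h1' := continuousOn_liExp_comp (k + 1) hξ
  have h2 := continuousOn_inv_tanh_comp hx
  have h3 : ContinuousOn (fun s : ℝ => 1 / (π * s : ℂ)) (Set.Ioi 0) :=
    ContinuousOn.div (by fun_prop) (by fun_prop) fun s hs => pi_mul_ofReal_ne_zero hs
  have h4 := continuousOn_liExp_two_pi (k + 1)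
  have h5 : ContinuousOn (fun s : ℝ => 1 / Complex.sinh (π * s / x) ^ 2) (Set.Ioi 0) :=
    ContinuousOn.div (by fun_prop) (by fun_prop) fun s hs =>
      pow_ne_zero _ (sinh_ne_zero_of_re_ne_zero (re_pi_mul_div_ne_zero hx hs))
  unfold JtfunDeriv
  fun_prop

theorem Adm.re_ne_zero {δ M : ℝ} {ξ x : ℂ} (hδ : 0 < δ) (h : Adm δ M ξ x) : x.re ≠ 0 := by
  simpa using inv_re_ne_zero (abs_pos.mp (hδ.trans_le h.le_abs_re))

theorem integrableOn_of_norm_le_rpow_mul_exp {f : ℝ → ℂ} {C c : ℝ} (hc : 0 < c)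
    (hf : ContinuousOn f (Set.Ioi 0))
    (h : ∀ s, 0 < s → ‖f s‖ ≤ C * (s ^ (-(1 / 2) : ℝ) * Real.exp (-c * s))) :
    IntegrableOn f (Set.Ioi 0) :=
  ((integrableOn_rpow_mul_exp hc).const_mul C).mono'
    (hf.aestronglyMeasurable measurableSet_Ioi)
    (ae_restrict_of_forall_mem measurableSet_Ioi h)

theorem norm_mul_le_rpow_mul_exp {f : ℝ → ℂ} {C c : ℝ}
    (h : ∀ s, 0 < s → ‖f s‖ ≤ C * (s ^ (-(1 / 2) : ℝ) * Real.exp (-c * s))) {s : ℝ} (hs : 0 ≤ s) :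
    ‖(s : ℂ) * f s‖ ≤ C * (s ^ (1 / 2 : ℝ) * Real.exp (-c * s)) := by
  rcases hs.eq_or_lt with rfl | hs
  · simp
  have h1 : s ^ (1 / 2 : ℝ) = s * s ^ (-(1 / 2) : ℝ) := by
    nth_rewrite 2 [← Real.rpow_one s]
    rw [← Real.rpow_add hs]
    norm_num
  rw [norm_mul, Complex.norm_real, Real.norm_of_nonneg hs.le, h1]
  calc _ ≤ s * (C * (s ^ (-(1 / 2) : ℝ) * Real.exp (-c * s))) := by gcongr; exact h s hs
    _ = _ := by ring

/-- If `t ↦ t * f t` has an integrable derivative and `f` is dominated by `t ^ (-1 / 2) * e ^ (-c t)`,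
then the boundary terms vanish. -/
theorem integral_deriv_mul_eq_zero {f f' : ℝ → ℂ} {C c : ℝ} (hc : 0 < c)
    (h : ∀ s, 0 < s → ‖f s‖ ≤ C * (s ^ (-(1 / 2) : ℝ) * Real.exp (-c * s)))
    (hd : ∀ s, 0 < s → HasDerivAt (fun t : ℝ => (t : ℂ) * f t) (f' s) s)
    (hi : IntegrableOn f' (Set.Ioi 0)) : ∫ s in Set.Ioi (0 : ℝ), f' s = 0 := by
  have hb : ∀ s : ℝ, 0 ≤ s → _ := fun s hs => norm_mul_le_rpow_mul_exp h hs
  have h0 : ContinuousWithinAt (fun t : ℝ => (t : ℂ) * f t) (Set.Ici 0) 0 := by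
    have hg : ContinuousAt (fun s : ℝ => C * (s ^ (1 / 2 : ℝ) * Real.exp (-c * s))) 0 :=
      continuousAt_const.mul ((Real.continuousAt_rpow_const _ _ (Or.inr (by norm_num))).mul
        (by fun_prop))
    have hg' := hg.tendsto.mono_left (nhdsWithin_le_nhds (s := Set.Ici 0))
    rw [Real.zero_rpow (by norm_num), zero_mul, mul_zero] at hg'
    rw [ContinuousWithinAt, Complex.ofReal_zero, zero_mul]
    exact squeeze_zero_norm' (eventually_nhdsWithin_of_forall hb) hg'
  have htop : Tendsto (fun t : ℝ => (t : ℂ) * f t) atTop (nhds 0) := by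
    have := (tendsto_rpow_mul_exp_neg_mul_atTop_nhds_zero (1 / 2) c hc).const_mul C
    rw [mul_zero] at this
    exact squeeze_zero_norm' ((eventually_ge_atTop 0).mono hb) this
  simpa using integral_Ioi_of_hasDerivAt_of_tendsto h0 hd hi htop

theorem hasDerivAt_Jt_of_integrable (k n : ℕ) {x ξ : ℂ} (hx : x.re ≠ 0) (hξ : (ξ / x).re < 1)
    (h : ξ = 0 ∨ 2 ≤ k + 1 + n) :
    HasDerivAt (fun y : ℂ => Jt (k + 1) n y ξ)
      (((n : ℂ) + 1) / x * Jt (k + 1) n x ξ - 2 * (π : ℂ) / x * Jt k (n + 1) x ξ) x := by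
  obtain ⟨δ, M, hδ, hδ1, hadm⟩ := exists_eventually_adm hx hξ
  obtain ⟨ρ, hρ, hball⟩ := Metric.eventually_nhds_iff_ball.mp hadm
  have hc : 0 < π * δ := by positivity
  obtain ⟨C, hC⟩ := exists_norm_Jtfun_le (k + 1) n ξ (by omega) h M hδ hδ1
  obtain ⟨C', hC'⟩ := exists_norm_Jtfun_le k (n + 1) ξ (by omega) (h.imp_right (by omega)) M hδ hδ1
  have hxa := hball x (Metric.mem_ball_self hρ)
  have hξ' : 0 < (1 - ξ / x).re := hδ.trans_le hxa.le_re
  have h0 : x ≠ 0 := by rintro rfl; simp at hx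
  have hF := integrableOn_of_norm_le_rpow_mul_exp hc (continuousOn_Jtfun (k + 1) n hx hξ') (hC x hxa)
  have hG := integrableOn_of_norm_le_rpow_mul_exp hc (continuousOn_Jtfun k (n + 1) hx hξ')
    (hC' x hxa)
  have hdiff : ∀ s : ℝ, 0 < s → ∀ y ∈ Metric.ball x ρ,
      HasDerivAt (fun y => Jtfun (k + 1) n y ξ s) (JtfunDeriv k n y ξ s) y := fun s hs y hy =>
    hasDerivAt_Jtfun k n ((hball y hy).re_ne_zero hδ) (hδ.trans_le (hball y hy).le_re) hs
  have hsub : ∀ y ∈ Metric.ball x (ρ / 2), Metric.closedBall y (ρ / 4) ⊆ Metric.ball x ρ :=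
    fun y hy z hz => by
      rw [Metric.mem_ball] at hy ⊢
      rw [Metric.mem_closedBall] at hz
      linarith [dist_triangle z y x]
  have hbound : ∀ s : ℝ, 0 < s → ∀ y ∈ Metric.ball x (ρ / 2), ‖JtfunDeriv k n y ξ s‖ ≤
      C * (s ^ (-(1 / 2) : ℝ) * Real.exp (-(π * δ) * s)) / (ρ / 4) := fun s hs y hy => by
    have hyρ : y ∈ Metric.ball x ρ := hsub y hy (Metric.mem_closedBall_self (by positivity))
    rw [← (hdiff s hs y hyρ).deriv]
    refine Complex.norm_deriv_le_of_forall_mem_sphere_norm_le (by positivity) ?_ fun z hz =>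
      hC z (hball z (hsub y hy (Metric.sphere_subset_closedBall hz))) s hs
    exact DifferentiableOn.diffContOnCl_ball (U := Metric.ball x ρ) (fun z hz =>
      (hdiff s hs z hz).differentiableAt.differentiableWithinAt) (hsub y hy)
  obtain ⟨hDint, hD⟩ := hasDerivAt_integral_of_dominated_loc_of_deriv_le
    (μ := volume.restrict (Set.Ioi (0 : ℝ)))
    (F := fun y s => Jtfun (k + 1) n y ξ s) (F' := fun y s => JtfunDeriv k n y ξ s)
    (Metric.ball_mem_nhds x (half_pos hρ))
    (hadm.mono fun y hy => (continuousOn_Jtfun (k + 1) n (hy.re_ne_zero hδ)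
      (hδ.trans_le hy.le_re)).aestronglyMeasurable measurableSet_Ioi)
    hF ((continuousOn_JtfunDeriv k n hx hξ').aestronglyMeasurable measurableSet_Ioi)
    (ae_restrict_of_forall_mem measurableSet_Ioi hbound)
    (((integrableOn_rpow_mul_exp hc).const_mul C).div_const (ρ / 4))
    (ae_restrict_of_forall_mem measurableSet_Ioi fun s hs y hy =>
      hdiff s hs y (hsub y hy (Metric.mem_closedBall_self (by positivity))))
  have hF1 := hF.const_mul ((n : ℂ) + 1)
  have hG1 := hG.const_mul (2 * π : ℂ)
  have hD1 := hDint.const_mul x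
  have hparts := integral_deriv_mul_eq_zero hc (hC x hxa)
    (fun s hs => hasDerivAt_mul_Jtfun k n hx hξ' hs) ((hF1.sub hG1).sub hD1)
  rw [integral_sub (by exact hF1.sub hG1) hD1, integral_sub hF1 hG1, integral_const_mul,
    integral_const_mul, integral_const_mul] at hparts
  refine (hD.const_mul ((-1 : ℂ) ^ (n + (k + 1) + 1))).congr_deriv ?_
  have hsign : n + 1 + k + 1 = n + (k + 1) + 1 := by ring
  unfold Jt
  rw [hsign]
  field_simp
  linear_combination -hparts

theorem integrableOn_JtfunReg (m n : ℕ) (hmn : 1 ≤ m + n) {x ξ : ℂ} (hx : x.re ≠ 0)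
    (hξ : (ξ / x).re < 1) : IntegrableOn (JtfunReg m n x ξ) (Set.Ioi 0) := by
  obtain ⟨δ, M, hδ, -, hadm⟩ := exists_eventually_adm hx hξ
  obtain ⟨C, hC⟩ := exists_norm_JtfunReg_le m n ξ hmn M hδ
  exact integrableOn_of_norm_le_rpow_mul_exp (by positivity)
    (continuousOn_JtfunReg m n hx (by simpa using hξ)) (hC x hadm.self_of_nhds)

theorem not_integrableOn_Jtfun (m n : ℕ) (hmn : 1 ≤ m + n) {x ξ : ℂ} (hx : x.re ≠ 0)
    (hξ : (ξ / x).re < 1) {ε : ℝ} (hε : 0 < ε)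
    (h : ∀ᶠ s : ℝ in nhdsWithin 0 (Set.Ioi 0), ε ≤ ‖(s : ℂ) ^ n *
      (liExp m (2 * π * (1 - ξ / x) * s) - liExp m (2 * π * s))‖) :
    ¬ IntegrableOn (Jtfun m n x ξ) (Set.Ioi 0) := by
  intro hJ
  have hS : IntegrableOn (JtfunSing m n x ξ) (Set.Ioi 0) := by
    refine (hJ.sub (integrableOn_JtfunReg m n hmn hx hξ)).congr ?_
    exact Eventually.of_forall fun s => by simp [Jtfun_eq_add]
  have h0 : 0 < ‖x‖ := norm_pos_iff.mpr (by rintro rfl; simp at hx)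
  obtain ⟨b, hb, hb'⟩ := (mem_nhdsGT_iff_exists_Ioc_subset).mp h
  have hb : (0 : ℝ) < b := hb
  have hinv : IntegrableOn (fun s : ℝ => s⁻¹) (Set.Ioc 0 b) := by
    refine ((hS.mono_set Set.Ioc_subset_Ioi_self).norm.const_mul (π / (‖x‖ * ε))).mono'
      (measurable_inv.aestronglyMeasurable)
      (ae_restrict_of_forall_mem measurableSet_Ioc fun s hs => ?_)
    have hs0 : 0 < s := hs.1
    have h1 := hb' hs
    rw [Set.mem_ofPred_eq] at h1
    have h2 : ‖JtfunSing m n x ξ s‖ = ‖x‖ / (π * s) * ‖(s : ℂ) ^ n *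
        (liExp m (2 * π * (1 - ξ / x) * s) - liExp m (2 * π * s))‖ := by
      rw [JtfunSing, mul_left_comm, norm_mul, norm_div, norm_mul (π : ℂ), Complex.norm_real,
        Complex.norm_real, Real.norm_of_nonneg pi_pos.le, Real.norm_of_nonneg hs0.le]
    rw [h2, Real.norm_of_nonneg (by positivity)]
    calc s⁻¹ = π / (‖x‖ * ε) * (‖x‖ / (π * s) * ε) := by field_simp
      _ ≤ _ := by gcongr
  have := (intervalIntegrable_iff_integrableOn_Ioc_of_le hb.le).mpr hinv
  rw [intervalIntegrable_inv_iff] at this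
  rcases this with h | h
  · exact hb.ne h
  · exact h Set.left_mem_uIcc

theorem tendsto_one_sub_exp_div (c : ℂ) :
    Tendsto (fun s : ℝ => (1 - Complex.exp (-(c * s))) / s) (nhdsWithin 0 (Set.Ioi 0)) (nhds c) := by
  have h1 : HasDerivAt (fun z : ℂ => 1 - Complex.exp (-(c * z))) c ((0 : ℝ) : ℂ) := by
    refine ((((hasDerivAt_id _).const_mul c).neg.cexp).const_sub 1).congr_deriv ?_
    simp
  have := h1.comp_ofReal.tendsto_slope_zero_right
  simp only [zero_add, Complex.ofReal_zero, mul_zero, neg_zero, Complex.exp_zero, sub_self,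
    sub_zero, Complex.real_smul, Complex.ofReal_inv] at this
  simpa only [div_eq_inv_mul] using this

theorem norm_exp_neg_lt_one {z : ℂ} (hz : 0 < z.re) : ‖Complex.exp (-z)‖ < 1 := by
  rw [Complex.norm_exp]
  simpa using hz

theorem exp_liExp_one {z : ℂ} (hz : 0 < z.re) :
    Complex.exp (liExp 1 z) = (1 - Complex.exp (-z))⁻¹ := by
  have h1 := norm_exp_neg_lt_one hz
  have h2 := (Complex.hasSum_taylorSeries_neg_log' h1).tsum_eq
  have h3 : liExp 1 z = -Complex.log (1 - Complex.exp (-z)) := by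
    rw [← h2]
    simp [liExp, Li]
  have h4 : 1 - Complex.exp (-z) ≠ 0 := by
    rw [sub_ne_zero]
    intro h
    rw [← h] at h1
    simp at h1
  rw [h3, Complex.exp_neg, Complex.exp_log h4]

theorem liExp_zero {z : ℂ} (hz : 0 < z.re) :
    liExp 0 z = Complex.exp (-z) / (1 - Complex.exp (-z)) := by
  simp [liExp, Li, pow_succ, tsum_mul_right, tsum_geometric_of_norm_lt_one (norm_exp_neg_lt_one hz)]
  ring

theorem tendsto_mul_liExp_zero {c : ℂ} (hc : 0 < c.re) :
    Tendsto (fun s : ℝ => (s : ℂ) * liExp 0 (2 * π * c * s)) (nhdsWithin 0 (Set.Ioi 0))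
      (nhds (2 * π * c)⁻¹) := by
  have hc0 : (2 * π * c : ℂ) ≠ 0 := by
    have : c ≠ 0 := by rintro rfl; simp at hc
    simp [this]
  have h1 := (tendsto_one_sub_exp_div (2 * π * c)).inv₀ hc0
  have h2 : Tendsto (fun s : ℝ => Complex.exp (-(2 * π * c * s))) (nhdsWithin 0 (Set.Ioi 0))
      (nhds 1) := by
    have : Continuous fun s : ℝ => Complex.exp (-(2 * π * c * s)) := by fun_prop
    simpa using (this.tendsto 0).mono_left (nhdsWithin_le_nhds (s := Set.Ioi 0))
  have h3 := h2.mul h1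
  rw [one_mul] at h3
  refine h3.congr' (eventually_nhdsWithin_of_forall fun s hs => ?_)
  simp only
  rw [liExp_zero (re_two_pi_mul_pos hc hs), inv_div]
  ring

theorem exists_le_norm_liExp_one_sub {a : ℂ} (ha : 0 < a.re) (ha1 : a ≠ 1) :
    ∃ ε > 0, ∀ᶠ s : ℝ in nhdsWithin 0 (Set.Ioi 0),
      ε ≤ ‖liExp 1 (2 * π * a * s) - liExp 1 (2 * π * s)‖ := by
  have ha0 : a ≠ 0 := by rintro rfl; simp at ha
  have hπ : (π : ℂ) ≠ 0 := by exact_mod_cast pi_ne_zero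
  have hlim : Tendsto (fun s : ℝ => Complex.exp (liExp 1 (2 * π * a * s) - liExp 1 (2 * π * s)))
      (nhdsWithin 0 (Set.Ioi 0)) (nhds a⁻¹) := by
    have := (tendsto_one_sub_exp_div (2 * π)).div (tendsto_one_sub_exp_div (2 * π * a))
      (by simp [ha0])
    rw [show (2 * π / (2 * π * a) : ℂ) = a⁻¹ by field_simp] at this
    refine this.congr' (eventually_nhdsWithin_of_forall fun s hs => ?_)
    have hs0 : (s : ℂ) ≠ 0 := by
      have : (0 : ℝ) < s := hs
      exact_mod_cast this.ne'
    simp only [Pi.div_apply]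
    rw [Complex.exp_sub, exp_liExp_one (re_two_pi_mul_pos ha hs),
      exp_liExp_one (by simpa using re_two_pi_mul_pos (a := 1) (by simp) hs),
      div_div_div_cancel_right₀ hs0, div_inv_eq_mul, inv_mul_eq_div]
  obtain ⟨U, V, hU, hV, hUV⟩ := t2_separation_nhds (inv_ne_one.mpr ha1)
  have hexp : ∀ᶠ d : ℂ in nhds 0, Complex.exp d ∈ V := by
    have := Complex.continuous_exp.tendsto 0
    rw [Complex.exp_zero] at this
    exact this hV
  obtain ⟨ε, hε, hball⟩ := Metric.eventually_nhds_iff_ball.mp hexp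
  refine ⟨ε, hε, (hlim.eventually_mem hU).mono fun s hs => ?_⟩
  by_contra! hlt
  exact Set.disjoint_left.mp hUV hs (hball _ (by simpa using hlt))

theorem exists_le_norm_liExp_zero_sub {a : ℂ} (ha : 0 < a.re) (ha1 : a ≠ 1) :
    ∃ ε > 0, ∀ᶠ s : ℝ in nhdsWithin 0 (Set.Ioi 0),
      ε ≤ ‖(s : ℂ) * (liExp 0 (2 * π * a * s) - liExp 0 (2 * π * s))‖ := by
  have hπ : (π : ℂ) ≠ 0 := by exact_mod_cast pi_ne_zero
  have h := ((tendsto_mul_liExp_zero ha).sub (tendsto_mul_liExp_zero (c := 1) (by simp))).norm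
  simp only [mul_one, ← mul_sub] at h
  have hpos : 0 < ‖(2 * π * a : ℂ)⁻¹ - (2 * π : ℂ)⁻¹‖ := by
    rw [norm_pos_iff, sub_ne_zero, Ne, inv_inj]
    simpa [hπ] using ha1
  exact ⟨_, half_pos hpos, (h.eventually_const_lt (half_lt_self hpos)).mono fun s hs => hs.le⟩

theorem one_sub_div_ne_one {x ξ : ℂ} (hx : x.re ≠ 0) (h : ξ ≠ 0) : 1 - ξ / x ≠ 1 := by
  have h0 : x ≠ 0 := by rintro rfl; simp at hx
  simpa using ⟨h, h0⟩

theorem Jt_one_zero_eq_zero {x ξ : ℂ} (hx : x.re ≠ 0) (hξ : (ξ / x).re < 1) (h : ξ ≠ 0) :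
    Jt 1 0 x ξ = 0 := by
  obtain ⟨ε, hε, hev⟩ := exists_le_norm_liExp_one_sub (a := 1 - ξ / x) (by simpa using hξ)
    (one_sub_div_ne_one hx h)
  have := not_integrableOn_Jtfun 1 0 le_rfl hx hξ hε (by simpa using hev)
  rw [Jt, integral_undef this, mul_zero]

theorem Jt_zero_one_eq_zero {x ξ : ℂ} (hx : x.re ≠ 0) (hξ : (ξ / x).re < 1) (h : ξ ≠ 0) :
    Jt 0 1 x ξ = 0 := by
  obtain ⟨ε, hε, hev⟩ := exists_le_norm_liExp_zero_sub (a := 1 - ξ / x) (by simpa using hξ)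
    (one_sub_div_ne_one hx h)
  have := not_integrableOn_Jtfun 0 1 le_rfl hx hξ hε (by simpa using hev)
  rw [Jt, integral_undef this, mul_zero]

theorem stmt6 (m n : ℕ) (hm : 1 ≤ m) (x ξ : ℂ) (hx : x.re ≠ 0) (hξ : (ξ / x).re < 1) :
    HasDerivAt (fun x' : ℂ => Jt m n x' ξ)
      (((n : ℂ) + 1) / x * Jt m n x ξ - 2 * (π : ℂ) / x * Jt (m - 1) (n + 1) x ξ) x := by
  obtain ⟨k, rfl⟩ := Nat.exists_eq_add_of_le' hm
  rw [Nat.add_sub_cancel]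
  by_cases h : ξ = 0 ∨ 2 ≤ k + 1 + n
  · exact hasDerivAt_Jt_of_integrable k n hx hξ h
  -- the integrals diverge here, so both sides are the default value
  push Not at h
  obtain ⟨h, hkn⟩ := h
  obtain ⟨rfl, rfl⟩ : k = 0 ∧ n = 0 := by omega
  obtain ⟨δ, M, hδ, -, hadm⟩ := exists_eventually_adm hx hξ
  rw [zero_add, Jt_one_zero_eq_zero hx hξ h, Jt_zero_one_eq_zero hx hξ h, mul_zero,
    mul_zero, sub_zero]
  refine (hasDerivAt_const x (0 : ℂ)).congr_of_eventuallyEq (hadm.mono fun y hy => ?_)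
  have hy' := hδ.trans_le hy.le_re
  exact Jt_one_zero_eq_zero (hy.re_ne_zero hδ) (by simpa using hy') h
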